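/- arXiv:1912.01492 — 3 statements merged into one kernel-verified Lean document; each statement's English description precedes it below -/
import Mathlib

section
/- Let T be a bounded linear operator on a nontrivial complex Hilbert space H. Then w(T) ≤ (1/2) ‖ |T| + |T*| ‖ − (1/2) · inf_{‖x‖=1} ( ⟨|T|x, x⟩^{1/2} − ⟨|T*|x, x⟩^{1/2} )². -/
open scoped InnerProductSpace NNReal

variable {H : Type*} [NormedAddCommGroup H] [InnerProductSpace ℂ H] [CompleteSpace H]

/-- The numerical radius `w(T) = sup { |⟨Tx, x⟩| : ‖x‖ = 1 }`. -/
noncomputable def numRadius (T : H →L[ℂ] H) : ℝ :=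
  ⨆ x : {x : H // ‖x‖ = 1}, ‖⟪T x.1, x.1⟫_ℂ‖

/-- The absolute value `|T| = (T*T)^(1/2)`. -/
noncomputable def opAbs (T : H →L[ℂ] H) : H →L[ℂ] H :=
  CFC.sqrt (star T * T)

/-- The real power `|T|^s` of the absolute value, via the continuous functional calculus. -/
noncomputable def opAbsPow (T : H →L[ℂ] H) (s : ℝ) : H →L[ℂ] H :=
  CFC.rpow (opAbs T) s

namespace OperatorAbs

lemma opAbs_nonneg (T : H →L[ℂ] H) : 0 ≤ opAbs T := CFC.sqrt_nonneg _

lemma opAbs_mul_opAbs (T : H →L[ℂ] H) : opAbs T * opAbs T = star T * T :=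
  CFC.sqrt_mul_sqrt_self _ (star_mul_self_nonneg T)

lemma star_opAbs (T : H →L[ℂ] H) : star (opAbs T) = opAbs T :=
  (IsSelfAdjoint.of_nonneg (opAbs_nonneg T)).star_eq

/-- If `D` solves the homogeneous Sylvester equation `B D + D A = 0` with `A, B ≥ 0`,
then `D A = 0`. -/
lemma mul_eq_zero_of_mul_add_mul_eq_zero {A B D : H →L[ℂ] H} (hA : 0 ≤ A) (hB : 0 ≤ B)
    (h : B * D + D * A = 0) : D * A = 0 := by
  have hAs : star A = A := (IsSelfAdjoint.of_nonneg hA).star_eq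
  have hBs : star B = B := (IsSelfAdjoint.of_nonneg hB).star_eq
  have hBD : B * D = -(D * A) := eq_neg_of_add_eq_zero_left h
  have hneg : star D * B * D = -(star D * D * A) := by
    rw [mul_assoc, hBD, mul_neg, mul_assoc]
  have hcomm : Commute (star D * D) A := by
    have h1 := congrArg star hneg
    simp only [star_mul, star_neg, star_star, hAs, hBs] at h1
    rw [← mul_assoc, hneg, neg_inj] at h1
    exact h1
  have hnonneg : 0 ≤ star D * D * A := Commute.mul_nonneg (star_mul_self_nonneg D) hA hcomm
  have hnonpos : 0 ≤ -(star D * D * A) := hneg ▸ star_left_conjugate_nonneg hB D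
  have hzero : star D * D * A = 0 := le_antisymm (neg_nonneg.mp hnonpos) hnonneg
  rw [← CStarRing.star_mul_self_eq_zero_iff, star_mul, mul_assoc, ← mul_assoc (star D), hzero,
    mul_zero]

/-- The intertwining relation `|T*| T = T |T|`. -/
lemma opAbs_star_mul (T : H →L[ℂ] H) : opAbs (star T) * T = T * opAbs T := by
  set A := opAbs T
  set B := opAbs (star T)
  have hA2 : A * A = star T * T := opAbs_mul_opAbs T
  have hB2 : B * B = T * star T := by simpa using opAbs_mul_opAbs (star T)
  have hAs : star A = A := star_opAbs T
  have hBs : star B = B := star_opAbs (star T)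
  have hsyl : B * (B * T - T * A) + (B * T - T * A) * A = 0 := by
    have h1 : B * (B * T - T * A) + (B * T - T * A) * A = B * B * T - T * (A * A) := by
      noncomm_ring
    rw [h1, hA2, hB2, mul_assoc, sub_self]
  have hDA : (B * T - T * A) * A = 0 :=
    mul_eq_zero_of_mul_add_mul_eq_zero (opAbs_nonneg T) (opAbs_nonneg (star T)) hsyl
  set D := B * T - T * A with hD
  have hBD : B * D = 0 := by rwa [hDA, add_zero] at hsyl
  have hDD : star D * D = -(A * (star T * D)) := by
    have : star D = star T * B - A * star T := by simp [hD, hAs, hBs]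
    rw [this, sub_mul, mul_assoc, hBD, mul_zero, zero_sub, mul_assoc]
  have hDD0 : star D * D = 0 := by
    rw [← CStarRing.star_mul_self_eq_zero_iff]
    rw [star_mul, star_star]
    nth_rewrite 2 [hDD]
    rw [mul_neg, mul_assoc, ← mul_assoc D A, hDA, zero_mul, mul_zero, neg_zero]
  exact sub_eq_zero.mp ((CStarRing.star_mul_self_eq_zero_iff D).mp hDD0)

lemma inner_left_eq_inner_right {A : H →L[ℂ] H} (hA : 0 ≤ A) (x y : H) :
    ⟪A x, y⟫_ℂ = ⟪x, A y⟫_ℂ := by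
  have h := ContinuousLinearMap.adjoint_inner_left A y x
  rwa [← ContinuousLinearMap.star_eq_adjoint, (IsSelfAdjoint.of_nonneg hA).star_eq] at h

lemma re_inner_nonneg {E : Type*} [NormedAddCommGroup E] [InnerProductSpace ℂ E]
    {A : E →L[ℂ] E} (hA : 0 ≤ A) (x : E) : 0 ≤ (⟪A x, x⟫_ℂ).re :=
  ((ContinuousLinearMap.nonneg_iff_isPositive A).mp hA).re_inner_nonneg_left x

/-- The Cauchy–Schwarz inequality for the semi-inner product of a positive operator. -/
lemma norm_inner_sq_le {C : H →L[ℂ] H} (hC : 0 ≤ C) (x y : H) :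
    ‖⟪C x, y⟫_ℂ‖ ^ 2 ≤ (⟪C x, x⟫_ℂ).re * (⟪C y, y⟫_ℂ).re := by
  have key (u v : H) : ⟪C u, v⟫_ℂ = ⟪CFC.sqrt C u, CFC.sqrt C v⟫_ℂ := by
    rw [← inner_left_eq_inner_right (CFC.sqrt_nonneg C), ← mul_apply_eq_comp,
      CFC.sqrt_mul_sqrt_self C hC]
  have hre (u : H) : (⟪u, u⟫_ℂ).re = ‖u‖ ^ 2 := inner_self_eq_norm_sq (𝕜 := ℂ) u
  rw [key, key, key, hre, hre, ← mul_pow]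
  gcongr
  exact norm_inner_le_norm _ _

lemma exists_add_smul_eq {B : H →L[ℂ] H} (hB : 0 ≤ B) {ε : ℝ} (hε : 0 < ε) (y : H) :
    ∃ v, B v + (ε : ℂ) • v = y := by
  have hunit : IsUnit (B + (ε : ℂ) • (1 : H →L[ℂ] H)) := by
    refine ContinuousLinearMap.isUnit_of_forall_le_norm_inner_map _ (c := ⟨ε, hε.le⟩) hε fun x ↦ ?_
    refine le_trans ?_ (Complex.re_le_norm _)
    have hre : (⟪x, x⟫_ℂ).re = ‖x‖ ^ 2 := inner_self_eq_norm_sq (𝕜 := ℂ) x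
    simp only [add_apply, smul_apply,
      one_apply_eq_self, inner_add_left, inner_smul_left, Complex.conj_ofReal,
      Complex.add_re, Complex.re_ofReal_mul, hre]
    change ‖x‖ ^ 2 * ε ≤ _
    nlinarith [re_inner_nonneg hB x]
  obtain ⟨v, hv⟩ := ((ContinuousLinearMap.isUnit_iff_bijective).mp hunit).2 y
  exact ⟨v, by simpa using hv⟩

/-- A perturbed form of the mixed Schwarz inequality. -/
lemma norm_inner_sq_le_add (T : H →L[ℂ] H) (x y : H) {ε : ℝ} (hε : 0 < ε) :
    ‖⟪T x, y⟫_ℂ‖ ^ 2 ≤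
      ((⟪opAbs T x, x⟫_ℂ).re + ε * ‖x‖ ^ 2) * (⟪opAbs (star T) y, y⟫_ℂ).re := by
  have hA0 := opAbs_nonneg T
  have hB0 := opAbs_nonneg (star T)
  have hint : star T * opAbs (star T) = opAbs T * star T := by
    simpa using (opAbs_star_mul (star T)).symm
  have hB2 : opAbs (star T) * opAbs (star T) = T * star T := by
    simpa using opAbs_mul_opAbs (star T)
  set A := opAbs T
  set B := opAbs (star T)
  obtain ⟨v, hv⟩ := exists_add_smul_eq hB0 hε y
  set C : H →L[ℂ] H := A + (ε : ℂ) • (1 : H →L[ℂ] H) with hC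
  have hC0 : 0 ≤ C := add_nonneg hA0 (by
    rw [ContinuousLinearMap.nonneg_iff_isPositive]
    exact ContinuousLinearMap.isPositive_one.smul_of_nonneg (by exact_mod_cast hε.le))
  have hTy : star T y = C (star T v) := by
    have := congrArg (fun S : H →L[ℂ] H ↦ S v) hint
    simp only [mul_apply_eq_comp] at this
    simp [hC, ← hv, this]
  have hTstar (u w : H) : ⟪T u, w⟫_ℂ = ⟪u, star T w⟫_ℂ :=
    (ContinuousLinearMap.adjoint_inner_right T u w).symm
  have hre (u : H) : (⟪u, u⟫_ℂ).re = ‖u‖ ^ 2 := inner_self_eq_norm_sq (𝕜 := ℂ) u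
  have hx : ⟪T x, y⟫_ℂ = ⟪C x, star T v⟫_ℂ := by
    rw [hTstar, hTy, inner_left_eq_inner_right hC0]
  have hCx : (⟪C x, x⟫_ℂ).re = (⟪A x, x⟫_ℂ).re + ε * ‖x‖ ^ 2 := by
    simp [hC, ← hre]
  have hCv : ⟪C (star T v), star T v⟫_ℂ = ⟪B y, B v⟫_ℂ := by
    rw [inner_left_eq_inner_right hB0, ← hTy, ← mul_apply_eq_comp B, hB2, mul_apply_eq_comp, ← inner_conj_symm, ← hTstar, inner_conj_symm]
  have hle : (⟪B y, B v⟫_ℂ).re ≤ (⟪B y, y⟫_ℂ).re := by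
    have h1 : (⟪B y, y⟫_ℂ).re = (⟪B y, B v⟫_ℂ).re + ε * (⟪B y, v⟫_ℂ).re := by
      rw [← Complex.re_ofReal_mul, ← Complex.add_re, ← inner_smul_right, ← inner_add_right, hv]
    have h2 : (⟪B y, v⟫_ℂ).re = ‖B v‖ ^ 2 + ε * (⟪B v, v⟫_ℂ).re := by
      rw [← hre, inner_left_eq_inner_right hB0, ← hv, inner_add_left, inner_smul_left,
        Complex.conj_ofReal, Complex.add_re, Complex.re_ofReal_mul,
        ← inner_left_eq_inner_right hB0 v v]
    have h3 := re_inner_nonneg hB0 v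
    rw [h1, h2]
    have : 0 ≤ ε * (‖B v‖ ^ 2 + ε * (⟪B v, v⟫_ℂ).re) := by positivity
    linarith
  rw [hx, ← hCx]
  refine (norm_inner_sq_le hC0 x (star T v)).trans ?_
  rw [hCv]
  exact mul_le_mul_of_nonneg_left hle (re_inner_nonneg hC0 x)

/-- The mixed Schwarz inequality `|⟨Tx, y⟩|² ≤ ⟨|T|x, x⟩ ⟨|T*|y, y⟩`. -/
theorem mixed_schwarz (T : H →L[ℂ] H) (x y : H) :
    ‖⟪T x, y⟫_ℂ‖ ^ 2 ≤ (⟪opAbs T x, x⟫_ℂ).re * (⟪opAbs (star T) y, y⟫_ℂ).re := by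
  have hcont : Continuous fun ε : ℝ ↦
      ((⟪opAbs T x, x⟫_ℂ).re + ε * ‖x‖ ^ 2) * (⟪opAbs (star T) y, y⟫_ℂ).re := by fun_prop
  have hlim := (hcont.tendsto 0).mono_left (nhdsWithin_le_nhds (s := Set.Ioi 0))
  simp only [zero_mul, add_zero] at hlim
  exact ge_of_tendsto hlim (eventually_mem_nhdsWithin.mono fun ε hε ↦
    norm_inner_sq_le_add T x y hε)

end OperatorAbs

theorem stmt17 [Nontrivial H] (T : H →L[ℂ] H) :
    numRadius T ≤
      (1 / 2 : ℝ) * ‖opAbs T + opAbs (star T)‖ -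
        (1 / 2 : ℝ) *
          ⨅ x : {x : H // ‖x‖ = 1},
            ((⟪(opAbs T) x.1, x.1⟫_ℂ).re ^ ((1 : ℝ) / 2) -
              (⟪(opAbs (star T)) x.1, x.1⟫_ℂ).re ^ ((1 : ℝ) / 2)) ^ 2 := by
  obtain ⟨x₀, hx₀⟩ := exists_norm_eq H zero_le_one
  have : Nonempty {x : H // ‖x‖ = 1} := ⟨⟨x₀, hx₀⟩⟩
  refine ciSup_le fun x ↦ ?_
  have hinf := ciInf_le (f := fun x : {x : H // ‖x‖ = 1} ↦
    ((⟪(opAbs T) x.1, x.1⟫_ℂ).re ^ ((1 : ℝ) / 2) -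
      (⟪(opAbs (star T)) x.1, x.1⟫_ℂ).re ^ ((1 : ℝ) / 2)) ^ 2)
    ⟨0, by rintro _ ⟨y, rfl⟩; positivity⟩ x
  have hsum : (⟪opAbs T x.1, x.1⟫_ℂ).re + (⟪opAbs (star T) x.1, x.1⟫_ℂ).re ≤
      ‖opAbs T + opAbs (star T)‖ := by
    rw [← Complex.add_re, ← inner_add_left, ← add_apply]
    refine (Complex.re_le_norm _).trans ((norm_inner_le_norm _ _).trans ?_)
    simpa [x.2] using (opAbs T + opAbs (star T)).le_opNorm x.1
  have hschwarz := Real.le_sqrt_of_sq_le (OperatorAbs.mixed_schwarz T x.1 x.1)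
  have ha := OperatorAbs.re_inner_nonneg (OperatorAbs.opAbs_nonneg T) x.1
  have hb := OperatorAbs.re_inner_nonneg (OperatorAbs.opAbs_nonneg (star T)) x.1
  rw [Real.sqrt_mul ha] at hschwarz
  simp only [← Real.sqrt_eq_rpow] at hinf ⊢
  nlinarith [Real.sq_sqrt ha, Real.sq_sqrt hb]
end

section
/- Let T be a bounded linear operator on a nontrivial complex Hilbert space H. Then w(T|T|) ≤ (1/2) ‖ T*T + TT* ‖ − (1/2) · inf_{‖x‖=1} ( ⟨|T|²x, x⟩^{1/2} − ⟨|T*|²x, x⟩^{1/2} )². -/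
open scoped InnerProductSpace NNReal

variable {H : Type*} [NormedAddCommGroup H] [InnerProductSpace ℂ H] [CompleteSpace H]

theorem opAbs_sq (T : H →L[ℂ] H) : opAbs T ^ 2 = star T * T :=
  CFC.sq_sqrt (star T * T) (star_mul_self_nonneg T)

theorem re_inner_star_mul_self (T : H →L[ℂ] H) (x : H) :
    (⟪(star T * T) x, x⟫_ℂ).re = ‖T x‖ ^ 2 := by
  rw [ContinuousLinearMap.star_eq_adjoint, mul_apply_eq_comp,
    ContinuousLinearMap.adjoint_inner_left]
  exact inner_self_eq_norm_sq (𝕜 := ℂ) (T x)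

theorem re_inner_opAbs_sq (T : H →L[ℂ] H) (x : H) :
    (⟪(opAbs T ^ 2) x, x⟫_ℂ).re = ‖T x‖ ^ 2 := by
  rw [opAbs_sq, re_inner_star_mul_self]

theorem norm_opAbs_apply (T : H →L[ℂ] H) (x : H) : ‖opAbs T x‖ = ‖T x‖ := by
  have hsa : star (opAbs T) = opAbs T :=
    (IsSelfAdjoint.of_nonneg (CFC.sqrt_nonneg (star T * T))).star_eq
  have h := re_inner_star_mul_self (opAbs T) x
  rw [hsa, ← pow_two, re_inner_opAbs_sq] at h
  exact ((pow_left_inj₀ (norm_nonneg _) (norm_nonneg _) two_ne_zero).1 h).symm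

theorem norm_inner_mul_opAbs_le (T : H →L[ℂ] H) (x : H) :
    ‖⟪(T * opAbs T) x, x⟫_ℂ‖ ≤ ‖T x‖ * ‖star T x‖ := by
  rw [mul_apply_eq_comp, ← ContinuousLinearMap.adjoint_inner_right,
    ← norm_opAbs_apply T x]
  exact norm_inner_le_norm _ _

theorem norm_sq_add_norm_star_sq_le (T : H →L[ℂ] H) {x : H} (hx : ‖x‖ = 1) :
    ‖T x‖ ^ 2 + ‖star T x‖ ^ 2 ≤ ‖star T * T + T * star T‖ := by
  have h := re_inner_star_mul_self (star T) x
  rw [star_star] at h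
  rw [← re_inner_star_mul_self, ← h, ← Complex.add_re, ← inner_add_left,
    ← add_apply]
  calc _ ≤ ‖⟪(star T * T + T * star T) x, x⟫_ℂ‖ := Complex.re_le_norm _
    _ ≤ ‖(star T * T + T * star T) x‖ * ‖x‖ := norm_inner_le_norm _ _
    _ ≤ ‖star T * T + T * star T‖ * ‖x‖ * ‖x‖ := by
      gcongr
      exact ContinuousLinearMap.le_opNorm _ _
    _ = _ := by rw [hx, mul_one, mul_one]

theorem stmt18 [Nontrivial H] (T : H →L[ℂ] H) :
    numRadius (T * opAbs T) ≤
      (1 / 2 : ℝ) * ‖star T * T + T * star T‖ -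
        (1 / 2 : ℝ) *
          ⨅ x : {x : H // ‖x‖ = 1},
            ((⟪(opAbs T ^ 2) x.1, x.1⟫_ℂ).re ^ ((1 : ℝ) / 2) -
              (⟪(opAbs (star T) ^ 2) x.1, x.1⟫_ℂ).re ^ ((1 : ℝ) / 2)) ^ 2 := by
  obtain ⟨x₀, hx₀⟩ := exists_norm_eq H zero_le_one
  have : Nonempty {x : H // ‖x‖ = 1} := ⟨⟨x₀, hx₀⟩⟩
  refine ciSup_le fun x => ?_
  have hinf := ciInf_le (f := fun x : {x : H // ‖x‖ = 1} =>
      ((⟪(opAbs T ^ 2) x.1, x.1⟫_ℂ).re ^ ((1 : ℝ) / 2) -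
        (⟪(opAbs (star T) ^ 2) x.1, x.1⟫_ℂ).re ^ ((1 : ℝ) / 2)) ^ 2)
    ⟨0, Set.forall_mem_range.2 fun _ => sq_nonneg _⟩ x
  have hroot (S : H →L[ℂ] H) : (⟪(opAbs S ^ 2) x.1, x.1⟫_ℂ).re ^ ((1 : ℝ) / 2) = ‖S x.1‖ := by
    rw [re_inner_opAbs_sq, ← Real.sqrt_eq_rpow, Real.sqrt_sq (norm_nonneg _)]
  have hbound : (⨅ x : {x : H // ‖x‖ = 1},
      ((⟪(opAbs T ^ 2) x.1, x.1⟫_ℂ).re ^ ((1 : ℝ) / 2) -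
        (⟪(opAbs (star T) ^ 2) x.1, x.1⟫_ℂ).re ^ ((1 : ℝ) / 2)) ^ 2) ≤
      (‖T x.1‖ - ‖star T x.1‖) ^ 2 := by
    rw [← hroot T, ← hroot (star T)]
    exact hinf
  have hprod := norm_inner_mul_opAbs_le T x.1
  have hsum := norm_sq_add_norm_star_sq_le T x.2
  linarith [sub_sq ‖T x.1‖ ‖star T x.1‖]
end

section
/- Let a, b > 0, let p, q > 1 with 1/p + 1/q = 1, set r₀ = min{1/p, 1/q}, and let m be a positive integer and r ≥ 1 a real number. Then (a^{1/p} b^{1/q})^m + r₀^m (a^{m/2} − b^{m/2})² ≤ ( a^r/p + b^r/q )^{m/r}. -/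
theorem pow_sub_pow_le_add_pow_sub_add_pow {P Q s : ℝ} (hQ : 0 ≤ Q) (hPQ : Q ≤ P) (hs : 0 ≤ s)
    (n : ℕ) : P ^ n - Q ^ n ≤ (P + s) ^ n - (Q + s) ^ n := by
  induction n with
  | zero => simp
  | succ k ih =>
    have h1 : Q ^ k ≤ P ^ k := pow_le_pow_left₀ hQ hPQ k
    have h2 : Q ^ k ≤ (Q + s) ^ k := pow_le_pow_left₀ hQ (by linarith) k
    have h3 : 0 ≤ s * ((P + s) ^ k - (Q + s) ^ k) := mul_nonneg hs (by linarith)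
    have h4 : 0 ≤ P * ((P + s) ^ k - (Q + s) ^ k - (P ^ k - Q ^ k)) :=
      mul_nonneg (hQ.trans hPQ) (by linarith)
    have h5 : 0 ≤ (P - Q) * ((Q + s) ^ k - Q ^ k) :=
      mul_nonneg (by linarith) (by linarith)
    simp only [pow_succ]
    linarith

theorem sq_pow_sub_pow_le {x y : ℝ} (hx : 0 ≤ x) (hy : 0 ≤ y) (n : ℕ) :
    (x ^ (n + 1) - y ^ (n + 1)) ^ 2 ≤ (x ^ 2 + y ^ 2) ^ (n + 1) - (2 * x * y) ^ (n + 1) := by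
  induction n with
  | zero => apply le_of_eq; ring
  | succ k ih =>
    have h1 := mul_le_mul_of_nonneg_left ih (by positivity : 0 ≤ x ^ 2 + y ^ 2)
    have h2 : (1 : ℝ) ≤ 2 ^ k := one_le_pow₀ (by norm_num)
    have h3 : 0 ≤ (2 ^ k - 1) * (2 * (x ^ (k + 1) * y ^ (k + 1)) * (x - y) ^ 2) :=
      mul_nonneg (by linarith) (by positivity)
    have h4 : 0 ≤ x ^ 2 * y ^ 2 * (x ^ k - y ^ k) ^ 2 := by positivity
    simp only [mul_pow] at *
    ring_nf at *
    linarith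

/-- The case `r = 1` of the refined Young inequality, with the smaller weight on `a`. -/
theorem geom_mean_pow_add_le_of_le {a b v w : ℝ} (ha : 0 < a) (hb : 0 < b) (hv : 0 ≤ v)
    (hvw : v ≤ w) (h1 : v + w = 1) {m : ℕ} (hm : 1 ≤ m) :
    (a ^ v * b ^ w) ^ m + v ^ m * (a ^ ((m : ℝ) / 2) - b ^ ((m : ℝ) / 2)) ^ 2 ≤
      (v * a + w * b) ^ m := by
  obtain ⟨x, hx, rfl⟩ : ∃ x : ℝ, 0 < x ∧ x ^ 2 = a :=
    ⟨√a, Real.sqrt_pos.2 ha, Real.sq_sqrt ha.le⟩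
  obtain ⟨y, hy, rfl⟩ : ∃ y : ℝ, 0 < y ∧ y ^ 2 = b :=
    ⟨√b, Real.sqrt_pos.2 hb, Real.sq_sqrt hb.le⟩
  have half_pow : ∀ z : ℝ, 0 < z → (z ^ 2) ^ ((m : ℝ) / 2) = z ^ m := fun z hz => by
    rw [← Real.rpow_natCast z 2, ← Real.rpow_mul hz.le, ← Real.rpow_natCast z m]
    congr 1
    push_cast
    ring
  rw [half_pow x hx, half_pow y hy]
  have young : (x ^ 2) ^ v * (y ^ 2) ^ w ≤ v * (2 * x * y) + (w - v) * y ^ 2 := by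
    have h := Real.geom_mean_le_arith_mean2_weighted (w₁ := 2 * v) (w₂ := w - v)
      (p₁ := x * y) (p₂ := y ^ 2) (by linarith) (by linarith) (by positivity) (by positivity)
      (by linarith)
    have e : (x ^ 2) ^ v * (y ^ 2) ^ w = (x * y) ^ (2 * v) * (y ^ 2) ^ (w - v) := by
      rw [Real.mul_rpow hx.le hy.le, Real.rpow_mul hx.le, Real.rpow_mul hy.le, mul_assoc,
        Real.rpow_two, Real.rpow_two, ← Real.rpow_add (by positivity)]
      congr 2
      ring
    rw [e]
    linarith
  have hG := pow_le_pow_left₀ (by positivity) young m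
  have hshift := pow_sub_pow_le_add_pow_sub_add_pow (P := v * (x ^ 2 + y ^ 2))
    (Q := v * (2 * x * y)) (s := (w - v) * y ^ 2) (by positivity)
    (mul_le_mul_of_nonneg_left (two_mul_le_add_sq x y) hv)
    (mul_nonneg (by linarith) (by positivity)) m
  have hsq : (x ^ m - y ^ m) ^ 2 ≤ (x ^ 2 + y ^ 2) ^ m - (2 * x * y) ^ m := by
    obtain ⟨n, rfl⟩ := Nat.exists_eq_add_of_le' hm
    exact sq_pow_sub_pow_le hx.le hy.le n
  have hscaled := mul_le_mul_of_nonneg_left hsq (pow_nonneg hv m)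
  have hA : v * (x ^ 2 + y ^ 2) + (w - v) * y ^ 2 = v * x ^ 2 + w * y ^ 2 := by ring
  rw [hA, mul_pow v, mul_pow v] at hshift
  linarith

/-- The case `r = 1` of the refined Young inequality. -/
theorem geom_mean_pow_add_le {a b v w : ℝ} (ha : 0 < a) (hb : 0 < b) (hv : 0 ≤ v)
    (hw : 0 ≤ w) (h1 : v + w = 1) {m : ℕ} (hm : 1 ≤ m) :
    (a ^ v * b ^ w) ^ m + min v w ^ m * (a ^ ((m : ℝ) / 2) - b ^ ((m : ℝ) / 2)) ^ 2 ≤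
      (v * a + w * b) ^ m := by
  rcases le_total v w with h | h
  · rw [min_eq_left h]
    exact geom_mean_pow_add_le_of_le ha hb hv h h1 hm
  · rw [min_eq_right h, mul_comm (a ^ v), sub_sq_comm, add_comm (v * a)]
    exact geom_mean_pow_add_le_of_le hb ha hw h (by linarith) hm

theorem stmt19 (a b : ℝ) (ha : 0 < a) (hb : 0 < b) (p q : ℝ) (hp : 1 < p) (hq : 1 < q)
    (hpq : 1 / p + 1 / q = 1) (m : ℕ) (hm : 1 ≤ m) (r : ℝ) (hr : 1 ≤ r) :
    (a ^ (1 / p) * b ^ (1 / q)) ^ m +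
        min (1 / p) (1 / q) ^ m * (a ^ ((m : ℝ) / 2) - b ^ ((m : ℝ) / 2)) ^ 2 ≤
      (a ^ r / p + b ^ r / q) ^ ((m : ℝ) / r) := by
  have hv : 0 ≤ 1 / p := by positivity
  have hw : 0 ≤ 1 / q := by positivity
  have hA : 0 ≤ 1 / p * a + 1 / q * b := by positivity
  refine (geom_mean_pow_add_le ha hb hv hw hpq hm).trans ?_
  have hmean : (1 / p * a + 1 / q * b) ^ r ≤ 1 / p * a ^ r + 1 / q * b ^ r :=
    (convexOn_rpow hr).2 ha.le hb.le hv hw hpq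
  calc (1 / p * a + 1 / q * b) ^ m
      = ((1 / p * a + 1 / q * b) ^ r) ^ ((m : ℝ) / r) := by
        rw [← Real.rpow_mul hA, mul_div_cancel₀ _ (by positivity), Real.rpow_natCast]
    _ ≤ (1 / p * a ^ r + 1 / q * b ^ r) ^ ((m : ℝ) / r) :=
        Real.rpow_le_rpow (by positivity) hmean (by positivity)
    _ = (a ^ r / p + b ^ r / q) ^ ((m : ℝ) / r) := by
        rw [one_div_mul_eq_div, one_div_mul_eq_div]
end
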